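/- arXiv:2207.10041 — 6 statements merged into one kernel-verified Lean document; each statement's English description precedes it below -/
import Mathlib

section
/- Let C be a regular category, A an object of C, and f : A ↠ B, g : A ↠ C regular epimorphisms. Then f and g admit a supremum in the preorder RegEpi(A) if and only if they admit a pushout in C. Moreover, in that case, if η₁ : B → H and η₂ : C → H form the pushout of f along g, then the composite η₁ ∘ f = η₂ ∘ g is a regular epimorphism and is a supremum of f and g in RegEpi(A). -/
/-!
STATEMENT 0: In a regular category, two regular epimorphisms f, g with common domain A
admit a supremum in the preorder RegEpi(A) iff they admit a pushout in C; and in that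
case, for any pushout (H, η₁, η₂) of f along g, the composite f ≫ η₁ (= g ≫ η₂) is a
regular epimorphism and a supremum of f and g in RegEpi(A).
-/

open CategoryTheory CategoryTheory.Limits

universe v u

/-- A regular category: finite limits, (regular epi, mono) factorisations, and
regular epimorphisms stable under pullback. -/
class RegularCat (C : Type u) [Category.{v} C] [HasFiniteLimits C] : Prop where
  factor : ∀ {X Y : C} (f : X ⟶ Y), ∃ (Z : C) (e : X ⟶ Z) (m : Z ⟶ Y),
      Nonempty (RegularEpi e) ∧ Mono m ∧ e ≫ m = f
  stable : ∀ {X Y Z : C} (f : X ⟶ Y) (g : Z ⟶ Y),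
      Nonempty (RegularEpi f) → Nonempty (RegularEpi (pullback.snd f g))

variable {C : Type u} [Category.{v} C]

/-- An object of the (large) preorder RegEpi(A): a regular epimorphism with domain A. -/
structure RegEpiOver (A : C) : Type (max u v) where
  cod : C
  hom : A ⟶ cod
  regEpi : Nonempty (RegularEpi hom)

/-- The preorder on RegEpi(A): f ≤ g iff g = h ∘ f for some h. -/
def RegEpiOver.le {A : C} (f g : RegEpiOver A) : Prop :=
  ∃ h : f.cod ⟶ g.cod, f.hom ≫ h = g.hom

/-- s is a supremum of f and g in the preorder RegEpi(A). -/
def RegEpiOver.IsSup {A : C} (f g s : RegEpiOver A) : Prop :=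
  f.le s ∧ g.le s ∧ ∀ t : RegEpiOver A, f.le t → g.le t → s.le t

/-- A commutative square `e ≫ m = f ≫ a` with `f` a regular epimorphism and `m` a monomorphism
admits a diagonal filler. -/
theorem exists_diagonal_of_regularEpi_of_mono {X Y Z W : C} {f : X ⟶ Y} (hf : RegularEpi f)
    {a : Y ⟶ W} {e : X ⟶ Z} {m : Z ⟶ W} [Mono m] (h : e ≫ m = f ≫ a) :
    ∃ d : Y ⟶ Z, f ≫ d = e ∧ d ≫ m = a := by
  have := hf.epi
  have he : hf.left ≫ e = hf.right ≫ e := by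
    rw [← cancel_mono m, Category.assoc, Category.assoc, h, reassoc_of% hf.w]
  obtain ⟨d, hd⟩ := Cofork.IsColimit.desc' hf.isColimit e he
  have hd : f ≫ d = e := hd
  exact ⟨d, hd, by rw [← cancel_epi f, reassoc_of% hd, h]⟩

namespace RegEpiOver

instance {A : C} (f : RegEpiOver A) : Epi f.hom :=
  f.regEpi.some.epi

/-- Every commutative square out of `f` and `g` factors through a common upper bound of `f` and `g`
by a monomorphism. -/
theorem exists_upperBound_of_comm [HasFiniteLimits C] [RegularCat C] {A : C} (f g : RegEpiOver A)
    {X : C} {a : f.cod ⟶ X} {b : g.cod ⟶ X} (w : f.hom ≫ a = g.hom ≫ b) :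
    ∃ (t : RegEpiOver A) (c : f.cod ⟶ t.cod) (d : g.cod ⟶ t.cod) (m : t.cod ⟶ X),
      Mono m ∧ f.hom ≫ c = t.hom ∧ g.hom ≫ d = t.hom ∧ c ≫ m = a ∧ d ≫ m = b := by
  obtain ⟨Z, e, m, he, hm, fac⟩ := RegularCat.factor (f.hom ≫ a)
  obtain ⟨hf⟩ := f.regEpi
  obtain ⟨hg⟩ := g.regEpi
  obtain ⟨c, hc, hcm⟩ := exists_diagonal_of_regularEpi_of_mono hf fac
  obtain ⟨d, hd, hdm⟩ := exists_diagonal_of_regularEpi_of_mono hg (fac.trans w)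
  exact ⟨⟨Z, e, he⟩, c, d, m, hm, hc, hd, hcm, hdm⟩

/-- A supremum of two regular epimorphisms yields a pushout. -/
theorem IsSup.hasPushout [HasFiniteLimits C] [RegularCat C] {A : C} {f g s : RegEpiOver A}
    (h : f.IsSup g s) : HasPushout f.hom g.hom := by
  obtain ⟨⟨p, hp⟩, ⟨q, hq⟩, hs⟩ := h
  have key : ∀ t : PushoutCocone f.hom g.hom,
      ∃ l : s.cod ⟶ t.pt, p ≫ l = t.inl ∧ q ≫ l = t.inr := by
    intro t
    obtain ⟨r, c, d, m, -, hc, hd, hcm, hdm⟩ := exists_upperBound_of_comm f g t.condition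
    obtain ⟨k, hk⟩ := hs r ⟨c, hc⟩ ⟨d, hd⟩
    refine ⟨k ≫ m, ?_, ?_⟩
    · rw [← cancel_epi f.hom, reassoc_of% hp, reassoc_of% hk, ← hcm, reassoc_of% hc]
    · rw [← cancel_epi g.hom, reassoc_of% hq, reassoc_of% hk, ← hdm, reassoc_of% hd]
  choose l hl hl' using key
  exact ⟨⟨⟨PushoutCocone.mk p q (hp.trans hq.symm), PushoutCocone.IsColimit.mk _ l hl hl'
    fun t n hn _ => by
      rw [← cancel_epi s.hom, ← hp, Category.assoc, Category.assoc, hn, hl]⟩⟩⟩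

/-- The diagonal of a pushout of regular epimorphisms is a regular epimorphism. -/
theorem regularEpi_of_isPushout [HasFiniteLimits C] [RegularCat C] {A : C} {f g : RegEpiOver A}
    {H : C} {η₁ : f.cod ⟶ H} {η₂ : g.cod ⟶ H} (h : IsPushout f.hom g.hom η₁ η₂) :
    Nonempty (RegularEpi (f.hom ≫ η₁)) := by
  obtain ⟨t, c, d, m, hm, hc, hd, hcm, hdm⟩ := exists_upperBound_of_comm f g h.w
  have hkm : h.desc c d (hc.trans hd.symm) ≫ m = 𝟙 H := by
    apply h.hom_ext <;> simp [hcm, hdm]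
  have : IsIso m := ⟨_, by rw [← cancel_mono m, Category.assoc, hkm]; simp, hkm⟩
  obtain ⟨ht⟩ := t.regEpi
  exact ⟨RegularEpi.ofArrowIso
    (Arrow.isoMk (f := .mk t.hom) (g := .mk (f.hom ≫ η₁)) (Iso.refl _) (asIso m)
      (by simp [← hc, hcm])) ht⟩

/-- The diagonal of a pushout of regular epimorphisms is their supremum. -/
theorem isSup_of_isPushout {A : C} {f g : RegEpiOver A} {H : C} {η₁ : f.cod ⟶ H} {η₂ : g.cod ⟶ H}
    (h : IsPushout f.hom g.hom η₁ η₂) (hre : Nonempty (RegularEpi (f.hom ≫ η₁))) :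
    f.IsSup g ⟨H, f.hom ≫ η₁, hre⟩ := by
  refine ⟨⟨η₁, rfl⟩, ⟨η₂, h.w.symm⟩, ?_⟩
  rintro t ⟨a, ha⟩ ⟨b, hb⟩
  exact ⟨h.desc a b (ha.trans hb.symm), by simp [ha]⟩

end RegEpiOver

theorem statement0 [HasFiniteLimits C] [RegularCat C] {A : C} (f g : RegEpiOver A) :
    ((∃ s : RegEpiOver A, f.IsSup g s) ↔ HasPushout f.hom g.hom) ∧
    (∀ (H : C) (η₁ : f.cod ⟶ H) (η₂ : g.cod ⟶ H) (w : f.hom ≫ η₁ = g.hom ≫ η₂),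
      Nonempty (IsColimit (PushoutCocone.mk η₁ η₂ w)) →
      ∃ hre : Nonempty (RegularEpi (f.hom ≫ η₁)),
        f.IsSup g ⟨H, f.hom ≫ η₁, hre⟩) := by
  refine ⟨⟨fun ⟨_, hs⟩ => hs.hasPushout, fun _ => ?_⟩, fun H η₁ η₂ w ⟨hc⟩ => ?_⟩
  · have h := IsPushout.of_hasPushout f.hom g.hom
    exact ⟨_, RegEpiOver.isSup_of_isPushout h (RegEpiOver.regularEpi_of_isPushout h)⟩
  · have h : IsPushout f.hom g.hom η₁ η₂ := ⟨⟨w⟩, ⟨hc⟩⟩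
    exact ⟨RegEpiOver.regularEpi_of_isPushout h, RegEpiOver.isSup_of_isPushout h _⟩
end

section
/- Let C be a regular category, A an object of C, P a complete lattice, and H : P^op → RegEpi(A) a monotone map. Then: (a) H sends the bottom element ⊥ of P to a maximum of the preorder RegEpi(A) if and only if γ_*H(⊥) is subterminal (the unique map γ_*H(⊥) → 1 is a monomorphism); (b) H preserves binary infima (i.e. H(p ∨ q) is an infimum of H(p) and H(q) in RegEpi(A) for all p, q ∈ P) if and only if for all p, q ∈ P the mediating morphism γ_*H(p ∨ q) → γ_*H(p) × γ_*H(q) is a monomorphism; (c) H preserves binary suprema (i.e. H(p ∧ q) is a supremum of H(p) and H(q) in RegEpi(A)) if and only if for all p, q ∈ P the square of restriction maps with vertices γ_*H(p ∨ q), γ_*H(p), γ_*H(q), γ_*H(p ∧ q) is a pushout in C; (d) H preserves directed suprema if and only if for every codirected subset D ⊆ P the cocone (γ_*H(p) → γ_*H(inf D))_{p∈D} is a colimit of the restriction of γ_*H to D. -/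
/-!
STATEMENT 3 (Proposition p:properties-H-presheaf): for a regular category C, an object A,
a complete lattice P, and a monotone map H : P^op → RegEpi(A), the four equivalences (a)-(d)
relating order-theoretic preservation properties of H with sheaf-like properties of the
presheaf γ_*H.  The presheaf γ_*H is encoded by the (uniquely determined) structure
`GammaStar H` of restriction maps.
-/

open CategoryTheory CategoryTheory.Limits

universe w v u

variable {C : Type u} [Category.{v} C]

variable {P : Type w} [CompleteLattice P]

/-- The presheaf γ_*H associated with a monotone map H : P^op → RegEpi(A): its
(uniquely determined) restriction maps, compatible with the quotient maps H(p). -/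
structure GammaStar {A : C} (H : P → RegEpiOver A) where
  map : ∀ {p q : P}, p ≤ q → ((H q).cod ⟶ (H p).cod)
  fac : ∀ {p q : P} (h : p ≤ q), (H q).hom ≫ map h = (H p).hom

/-- The elementwise statement that the cocone (γ_*H(p) → γ_*H(inf D))_{p ∈ D} is a
colimit of the restriction of γ_*H to the codirected set D. -/
def GammaStar.IsColimitAtInf {A : C} {H : P → RegEpiOver A} (G : GammaStar H)
    (D : Set P) : Prop :=
  ∀ (B : C) (c : ∀ p ∈ D, (H p).cod ⟶ B),
    (∀ p q (hp : p ∈ D) (hq : q ∈ D) (hpq : p ≤ q), G.map hpq ≫ c p hp = c q hq) →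
    ∃! u : (H (sInf D)).cod ⟶ B, ∀ p (hp : p ∈ D), G.map (sInf_le hp) ≫ u = c p hp

namespace RegEpiOver

theorem epi_hom {A : C} (s : RegEpiOver A) : Epi s.hom :=
  let ⟨r⟩ := s.regEpi
  r.epi

/-- Regular epimorphisms are orthogonal to monomorphisms. -/
theorem le_of_mono {A B : C} {s t : RegEpiOver A} (g : s.cod ⟶ B) (m : t.cod ⟶ B) [Mono m]
    (w : s.hom ≫ g = t.hom ≫ m) : s.le t := by
  obtain ⟨r⟩ := s.regEpi
  have hw : r.left ≫ t.hom = r.right ≫ t.hom := by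
    rw [← cancel_mono m, Category.assoc, Category.assoc, ← w, reassoc_of% r.w]
  exact ⟨r.desc' t.hom hw, (r.desc' t.hom hw).2⟩

/-- A morphism out of `s` is a monomorphism as soon as `s` is above the image quotient. -/
theorem mono_of_le {A B : C} {s t : RegEpiOver A} (g : s.cod ⟶ B) (m : t.cod ⟶ B) [Mono m]
    (w : s.hom ≫ g = t.hom ≫ m) (hts : t.le s) : Mono g := by
  obtain ⟨k, hk⟩ := le_of_mono g m w
  obtain ⟨h, hh⟩ := hts
  have := s.epi_hom
  have hkh : k ≫ h = 𝟙 _ := by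
    rw [← cancel_epi s.hom, reassoc_of% hk, hh, Category.comp_id]
  have hkm : k ≫ m = g := by
    rw [← cancel_epi s.hom, reassoc_of% hk, w]
  have : IsSplitMono k := ⟨⟨⟨h, hkh⟩⟩⟩
  rw [← hkm]
  infer_instance

theorem exists_image [HasFiniteLimits C] [RegularCat C] {A B : C} (f : A ⟶ B) :
    ∃ (t : RegEpiOver A) (m : t.cod ⟶ B), Mono m ∧ t.hom ≫ m = f := by
  obtain ⟨Z, e, m, he, hm, hf⟩ := RegularCat.factor f
  exact ⟨⟨Z, e, he⟩, m, hm, hf⟩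

end RegEpiOver

/-- A compatible family of morphisms out of members of a family of quotients factors through
any quotient that is a least upper bound of the family. -/
theorem RegEpiOver.exists_desc [HasFiniteLimits C] [RegularCat C] {A B : C} {ι : Type*}
    {K : ι → RegEpiOver A} {s : RegEpiOver A}
    (hs : ∀ t : RegEpiOver A, (∀ i, (K i).le t) → s.le t)
    (f : A ⟶ B) (c : ∀ i, (K i).cod ⟶ B) (hc : ∀ i, (K i).hom ≫ c i = f) :
    ∃ u : s.cod ⟶ B, s.hom ≫ u = f := by
  obtain ⟨t, m, hm, ht⟩ := exists_image f
  obtain ⟨u, hu⟩ := hs t fun i => le_of_mono (c i) m ((hc i).trans ht.symm)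
  exact ⟨u ≫ m, by rw [reassoc_of% hu, ht]⟩

theorem statement3 [HasFiniteLimits C] [RegularCat C] {A : C}
    (H : P → RegEpiOver A) (hH : ∀ {p q : P}, p ≤ q → (H q).le (H p))
    (G : GammaStar H) :
    -- (a)
    ((∀ t : RegEpiOver A, t.le (H (⊥ : P))) ↔ Mono (terminal.from (H (⊥ : P)).cod)) ∧
    -- (b)
    ((∀ p q : P, (H (p ⊔ q)).le (H p) ∧ (H (p ⊔ q)).le (H q) ∧
        ∀ t : RegEpiOver A, t.le (H p) → t.le (H q) → t.le (H (p ⊔ q))) ↔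
      (∀ p q : P, Mono (prod.lift (G.map (le_sup_left : p ≤ p ⊔ q))
        (G.map (le_sup_right : q ≤ p ⊔ q))))) ∧
    -- (c)
    ((∀ p q : P, (H p).le (H (p ⊓ q)) ∧ (H q).le (H (p ⊓ q)) ∧
        ∀ t : RegEpiOver A, (H p).le t → (H q).le t → (H (p ⊓ q)).le t) ↔
      (∀ p q : P, IsPushout (G.map (le_sup_left : p ≤ p ⊔ q))
        (G.map (le_sup_right : q ≤ p ⊔ q))
        (G.map (inf_le_left : p ⊓ q ≤ p)) (G.map (inf_le_right : p ⊓ q ≤ q)))) ∧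
    -- (d)
    ((∀ D : Set P, D.Nonempty → DirectedOn (· ≥ ·) D →
        (∀ p ∈ D, (H p).le (H (sInf D))) ∧
        ∀ t : RegEpiOver A, (∀ p ∈ D, (H p).le t) → (H (sInf D)).le t) ↔
      (∀ D : Set P, D.Nonempty → DirectedOn (· ≥ ·) D → G.IsColimitAtInf D)) := by
  have epiH (p : P) : Epi (H p).hom := (H p).epi_hom
  refine ⟨⟨fun h => ?_, fun h t => ?_⟩, ⟨fun h p q => ?_, fun h p q => ?_⟩,
    ⟨fun h p q => ?_, fun h p q => ?_⟩, ⟨fun h D hne hD => ?_, fun h D hne hD => ?_⟩⟩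
  · obtain ⟨t, m, hm, -⟩ := RegEpiOver.exists_image (terminal.from A)
    exact RegEpiOver.mono_of_le _ m (Subsingleton.elim _ _) (h t)
  · exact RegEpiOver.le_of_mono (terminal.from _) (terminal.from (H ⊥).cod)
      (Subsingleton.elim _ _)
  · obtain ⟨t, m, hm, ht⟩ := RegEpiOver.exists_image ((H (p ⊔ q)).hom ≫
      prod.lift (G.map (le_sup_left : p ≤ p ⊔ q)) (G.map (le_sup_right : q ≤ p ⊔ q)))
    refine RegEpiOver.mono_of_le _ m ht.symm ((h p q).2.2 t ⟨m ≫ prod.fst, ?_⟩ ⟨m ≫ prod.snd, ?_⟩)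
    · rw [reassoc_of% ht, prod.lift_fst, G.fac]
    · rw [reassoc_of% ht, prod.lift_snd, G.fac]
  · refine ⟨hH le_sup_left, hH le_sup_right, fun t ⟨a, ha⟩ ⟨b, hb⟩ => ?_⟩
    have := h p q
    refine RegEpiOver.le_of_mono (prod.lift a b) (prod.lift (G.map (le_sup_left : p ≤ p ⊔ q))
      (G.map (le_sup_right : q ≤ p ⊔ q))) ?_
    rw [prod.comp_lift, prod.comp_lift, ha, hb, G.fac, G.fac]
  · have comm : CommSq (G.map (le_sup_left : p ≤ p ⊔ q)) (G.map (le_sup_right : q ≤ p ⊔ q))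
        (G.map (inf_le_left : p ⊓ q ≤ p)) (G.map (inf_le_right : p ⊓ q ≤ q)) := ⟨by
      rw [← cancel_epi (H (p ⊔ q)).hom, reassoc_of% G.fac, reassoc_of% G.fac, G.fac, G.fac]⟩
    have desc (s : PushoutCocone (G.map (le_sup_left : p ≤ p ⊔ q))
        (G.map (le_sup_right : q ≤ p ⊔ q))) :
        ∃ u : (H (p ⊓ q)).cod ⟶ s.pt, (H (p ⊓ q)).hom ≫ u = (H p).hom ≫ s.inl := by
      refine RegEpiOver.exists_desc (K := fun b : Bool => H (cond b p q))
        (fun t ht => (h p q).2.2 t (ht true) (ht false)) _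
        (fun b => match b with
          | true => s.inl
          | false => s.inr) ?_
      rintro (_ | _)
      · change (H q).hom ≫ s.inr = _
        rw [← G.fac (le_sup_left : p ≤ p ⊔ q), ← G.fac (le_sup_right : q ≤ p ⊔ q),
          Category.assoc, Category.assoc, s.condition]
      · rfl
    choose u hu using desc
    refine ⟨comm, ⟨PushoutCocone.IsColimit.mk _ u (fun s => ?_) (fun s => ?_)
      (fun s m hl _ => ?_)⟩⟩
    · rw [← cancel_epi (H p).hom, reassoc_of% G.fac, hu]
    · rw [← cancel_epi (H q).hom, reassoc_of% G.fac, hu,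
        ← G.fac (le_sup_left : p ≤ p ⊔ q), ← G.fac (le_sup_right : q ≤ p ⊔ q),
        Category.assoc, Category.assoc, s.condition]
    · rw [← cancel_epi (H (p ⊓ q)).hom, hu, ← hl, reassoc_of% G.fac]
  · refine ⟨hH inf_le_left, hH inf_le_right, fun t ⟨a, ha⟩ ⟨b, hb⟩ => ?_⟩
    have w : G.map (le_sup_left : p ≤ p ⊔ q) ≫ a = G.map (le_sup_right : q ≤ p ⊔ q) ≫ b := by
      rw [← cancel_epi (H (p ⊔ q)).hom, reassoc_of% G.fac, reassoc_of% G.fac, ha, hb]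
    refine ⟨(h p q).desc a b w, ?_⟩
    rw [← G.fac (inf_le_left : p ⊓ q ≤ p), Category.assoc, (h p q).inl_desc, ha]
  · intro B c hc
    obtain ⟨p₀, hp₀⟩ := hne
    have hom_comp_eq (p q : P) (hp : p ∈ D) (hq : q ∈ D) :
        (H p).hom ≫ c p hp = (H q).hom ≫ c q hq := by
      obtain ⟨r, hr, hrp, hrq⟩ := hD p hp q hq
      rw [← hc r p hr hp hrp, ← hc r q hr hq hrq, reassoc_of% G.fac, reassoc_of% G.fac]
    obtain ⟨u, hu⟩ := RegEpiOver.exists_desc (K := fun p : D => H p)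
      (fun t ht => (h D ⟨p₀, hp₀⟩ hD).2 t fun p hp => ht ⟨p, hp⟩) ((H p₀).hom ≫ c p₀ hp₀)
      (fun p => c p p.2) (fun p => hom_comp_eq p p₀ p.2 hp₀)
    refine ⟨u, fun p hp => ?_, fun v hv => ?_⟩
    · rw [← cancel_epi (H p).hom, reassoc_of% G.fac, hu, hom_comp_eq p p₀ hp hp₀]
    · rw [← cancel_epi (H (sInf D)).hom, hu, ← hv p₀ hp₀, reassoc_of% G.fac]
  · refine ⟨fun p hp => hH (sInf_le hp), fun t ht => ?_⟩
    choose c hc using ht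
    obtain ⟨u, hu, -⟩ := h D hne hD t.cod c fun p q hp hq hpq => by
      rw [← cancel_epi (H q).hom, reassoc_of% G.fac, hc, hc]
    obtain ⟨p₀, hp₀⟩ := hne
    exact ⟨u, by rw [← G.fac (sInf_le hp₀), Category.assoc, hu p₀ hp₀, hc]⟩
end

section
/- Let C be a regular category, A an object of C, P a complete lattice, and H : P^op → RegEpi(A) a monotone map. The following are equivalent: (1) H preserves binary infima and binary suprema, and any two regular epimorphisms in the image of H ker-commute; (2) for all p, q ∈ P, the square of restriction maps with vertices γ_*H(p ∨ q), γ_*H(p), γ_*H(q), γ_*H(p ∧ q) is a pullback in C. -/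
open CategoryTheory CategoryTheory.Limits

universe w v u

variable {C : Type u} [Category.{v} C]

variable [HasFiniteLimits C]

/-- The kernel pair of f, as a map into A ⨯ A. -/
noncomputable def kerPairMap {A B : C} (f : A ⟶ B) : pullback f f ⟶ A ⨯ A :=
  prod.lift (pullback.fst f f) (pullback.snd f f)

/-- The object U in the construction of the composite of two relations r : R ↣ A × A and
s : S ↣ A × A: the equaliser of the two maps R ⨯ S ⟶ A given by the second leg of r and
the first leg of s. -/
noncomputable def relCompDom {A R S : C} (r : R ⟶ A ⨯ A) (s : S ⟶ A ⨯ A) : C :=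
  equalizer ((prod.fst : R ⨯ S ⟶ R) ≫ r ≫ (prod.snd : A ⨯ A ⟶ A))
    ((prod.snd : R ⨯ S ⟶ S) ≫ s ≫ (prod.fst : A ⨯ A ⟶ A))

/-- The canonical map U ⟶ A ⨯ A whose image is the composite relation r ∘ s. -/
noncomputable def relCompMap {A R S : C} (r : R ⟶ A ⨯ A) (s : S ⟶ A ⨯ A) :
    relCompDom r s ⟶ A ⨯ A :=
  equalizer.ι _ _ ≫
    prod.lift ((prod.fst : R ⨯ S ⟶ R) ≫ r ≫ (prod.fst : A ⨯ A ⟶ A))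
      ((prod.snd : R ⨯ S ⟶ S) ≫ s ≫ (prod.snd : A ⨯ A ⟶ A))

/-- t : T ⟶ A ⨯ A is (an image factorisation of) the composite relation of r and s. -/
def IsRelComp {A R S T : C} (r : R ⟶ A ⨯ A) (s : S ⟶ A ⨯ A) (t : T ⟶ A ⨯ A) : Prop :=
  ∃ e : relCompDom r s ⟶ T, Nonempty (RegularEpi e) ∧ e ≫ t = relCompMap r s

/-- Two monomorphisms into X determine the same subobject. -/
def SameSub {X T W : C} (t : T ⟶ X) (w : W ⟶ X) : Prop :=
  (∃ u : T ⟶ W, u ≫ w = t) ∧ (∃ v : W ⟶ T, v ≫ t = w)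

/-- A relation t on A is effective if it is, as a subobject of A ⨯ A, the kernel pair
of some morphism. -/
def IsEffective {A T : C} (t : T ⟶ A ⨯ A) : Prop :=
  ∃ (B : C) (h : A ⟶ B), SameSub t (kerPairMap h)

/-- Two regular epimorphisms with domain A ker-commute: the composites
ker f ∘ ker g and ker g ∘ ker f coincide (as subobjects of A ⨯ A) and this composite
is an effective equivalence relation. -/
def KerCommute {A : C} (f g : RegEpiOver A) : Prop :=
  ∃ (T : C) (t : T ⟶ A ⨯ A), Mono t ∧
    IsRelComp (kerPairMap f.hom) (kerPairMap g.hom) t ∧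
    IsRelComp (kerPairMap g.hom) (kerPairMap f.hom) t ∧
    IsEffective t

variable {P : Type w} [CompleteLattice P]

section

variable {A B D E : C}

lemma RegularEpi.toStrongEpi {C : Type u} [Category.{v} C] {X Y : C} {f : X ⟶ Y}
    (h : Nonempty (RegularEpi f)) :
    StrongEpi f :=
  have : IsRegularEpi f := ⟨h⟩
  inferInstance

lemma RegEpiOver.exists_hom_comp_eq {C : Type u} [Category.{v} C] {A : C}
    {s : RegEpiOver A} {Z : C} (k : A ⟶ Z)
    (h : ∀ ⦃X : C⦄ (x z : X ⟶ A), x ≫ s.hom = z ≫ s.hom → x ≫ k = z ≫ k) :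
    ∃ l : s.cod ⟶ Z, s.hom ≫ l = k :=
  have hs := s.regEpi.some
  ⟨_, (hs.desc' k (h _ _ hs.w)).2⟩

/-- A regular epimorphism is the coequaliser of its kernel pair, so `≤` is detected by
generalised elements. -/
lemma RegEpiOver.le_iff_forall_comp_eq {C : Type u} [Category.{v} C] {A : C}
    {s t : RegEpiOver A} :
    s.le t ↔ ∀ ⦃X : C⦄ (x z : X ⟶ A), x ≫ s.hom = z ≫ s.hom → x ≫ t.hom = z ≫ t.hom := by
  refine ⟨?_, fun h => exists_hom_comp_eq _ h⟩
  rintro ⟨l, hl⟩ X x z h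
  rw [← hl, reassoc_of% h]

@[simp]
lemma kerPairMap_fst (f : A ⟶ B) : kerPairMap f ≫ prod.fst = pullback.fst f f :=
  prod.lift_fst _ _

@[simp]
lemma kerPairMap_snd (f : A ⟶ B) : kerPairMap f ≫ prod.snd = pullback.snd f f :=
  prod.lift_snd _ _

instance (f : A ⟶ B) : Mono (kerPairMap f) where
  right_cancellation u v h := by
    ext
    · simpa using h =≫ prod.fst
    · simpa using h =≫ prod.snd

lemma lift_comp_kerPairMap {X : C} {f : A ⟶ B} {x z : X ⟶ A} (h : x ≫ f = z ≫ f) :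
    pullback.lift x z h ≫ kerPairMap f = prod.lift x z := by
  ext <;> simp [prod.lift_fst, prod.lift_snd, pullback.lift_fst, pullback.lift_snd]

lemma lift_eq_comp_kerPairMap (f : A ⟶ B) {X : C} (s : X ⟶ pullback f f) :
    prod.lift (s ≫ pullback.fst f f) (s ≫ pullback.snd f f) = s ≫ kerPairMap f := by
  ext <;> simp [prod.lift_fst, prod.lift_snd]

lemma exists_comp_relCompMap_eq_lift {R S X : C} {r : R ⟶ A ⨯ A} {s : S ⟶ A ⨯ A}
    (u : X ⟶ R) (v : X ⟶ S) (h : u ≫ r ≫ prod.snd = v ≫ s ≫ prod.fst) :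
    ∃ l : X ⟶ relCompDom r s,
      l ≫ relCompMap r s = prod.lift (u ≫ r ≫ prod.fst) (v ≫ s ≫ prod.snd) := by
  refine ⟨equalizer.lift (prod.lift u v)
    (by simpa [prod.lift_fst_assoc, prod.lift_snd_assoc] using h), ?_⟩
  refine (equalizer.lift_ι_assoc _ _ _).trans ?_
  simp

lemma exists_relCompMap_eq_lift {R S : C} (r : R ⟶ A ⨯ A) (s : S ⟶ A ⨯ A) :
    ∃ (u : relCompDom r s ⟶ R) (v : relCompDom r s ⟶ S),
      u ≫ r ≫ prod.snd = v ≫ s ≫ prod.fst ∧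
        relCompMap r s = prod.lift (u ≫ r ≫ prod.fst) (v ≫ s ≫ prod.snd) := by
  refine ⟨equalizer.ι _ _ ≫ prod.fst, equalizer.ι _ _ ≫ prod.snd, ?_, ?_⟩
  · exact (Category.assoc _ _ _).trans ((equalizer.condition _ _).trans
      (Category.assoc _ _ _).symm)
  · refine (prod.comp_lift _ _ _).trans ?_
    congr 1 <;> exact (Category.assoc _ _ _).symm

/-- Generalised elements of the composite of two kernel pairs. -/
lemma exists_comp_relCompMap_eq {X : C} {f : A ⟶ B} {g : A ⟶ D} {x y z : X ⟶ A}
    (hxy : x ≫ f = y ≫ f) (hyz : y ≫ g = z ≫ g) :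
    ∃ r : X ⟶ relCompDom (kerPairMap f) (kerPairMap g),
      r ≫ relCompMap (kerPairMap f) (kerPairMap g) = prod.lift x z := by
  simpa [pullback.lift_fst, pullback.lift_snd] using exists_comp_relCompMap_eq_lift
    (r := kerPairMap f) (s := kerPairMap g) (pullback.lift x y hxy) (pullback.lift y z hyz)
    (by simp [pullback.lift_fst, pullback.lift_snd])

lemma exists_of_relCompDom (f : A ⟶ B) (g : A ⟶ D) :
    ∃ x y z : relCompDom (kerPairMap f) (kerPairMap g) ⟶ A,
      x ≫ f = y ≫ f ∧ y ≫ g = z ≫ g ∧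
        relCompMap (kerPairMap f) (kerPairMap g) = prod.lift x z := by
  obtain ⟨u, v, h, h'⟩ := exists_relCompMap_eq_lift (kerPairMap f) (kerPairMap g)
  simp only [kerPairMap_fst, kerPairMap_snd] at h h'
  exact ⟨u ≫ pullback.fst f f, u ≫ pullback.snd f f, v ≫ pullback.snd g g,
    by simp [pullback.condition], by rw [h]; simp [pullback.condition], h'⟩

lemma SameSub.comp_eq {T : C} {t : T ⟶ A ⨯ A} {k : A ⟶ E} (h : SameSub t (kerPairMap k)) :
    t ≫ prod.fst ≫ k = t ≫ prod.snd ≫ k := by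
  obtain ⟨⟨u, rfl⟩, -⟩ := h
  simp only [Category.assoc, reassoc_of% kerPairMap_fst k, reassoc_of% kerPairMap_snd k,
    pullback.condition]

lemma SameSub.exists_comp_eq {T X : C} {t : T ⟶ A ⨯ A} {k : A ⟶ E}
    (h : SameSub t (kerPairMap k)) {x z : X ⟶ A} (hxz : x ≫ k = z ≫ k) :
    ∃ w : X ⟶ T, w ≫ t = prod.lift x z := by
  obtain ⟨-, v, hv⟩ := h
  refine ⟨pullback.lift x z hxz ≫ v, ?_⟩
  rw [Category.assoc, hv, lift_comp_kerPairMap]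

variable [RegularCat C]

lemma RegularCat.regularEpi_of_strongEpi {X Y : C} (f : X ⟶ Y) [StrongEpi f] :
    Nonempty (RegularEpi f) := by
  obtain ⟨Z, e, m, ⟨he⟩, hm, rfl⟩ := RegularCat.factor f
  have := strongEpi_of_strongEpi e m
  have := isIso_of_mono_of_strongEpi m
  exact ⟨he.ofArrowIso (Arrow.isoMk (f := Arrow.mk e) (g := Arrow.mk (e ≫ m))
    (Iso.refl _) (asIso m))⟩

/-- Generalised elements lift locally along a strong epimorphism. -/
lemma RegularCat.exists_local_lift {X Q : C} (c : A ⟶ Q) [StrongEpi c] (q : X ⟶ Q) :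
    ∃ (X' : C) (s : X' ⟶ X) (y : X' ⟶ A), StrongEpi s ∧ y ≫ c = s ≫ q :=
  ⟨_, pullback.snd c q, pullback.fst c q,
    RegularEpi.toStrongEpi (RegularCat.stable c q (regularEpi_of_strongEpi c)),
    pullback.condition⟩

/-- If `A` covers the pullback of two of its quotients, the composite of their kernel pairs is
the kernel pair of the diagonal of the square. -/
lemma isRelComp_kerPairMap {Q : C} {c : A ⟶ Q} [StrongEpi c] {a' : Q ⟶ B} {b' : Q ⟶ D}
    {a : B ⟶ E} {b : D ⟶ E} (sq : IsPullback a' b' a b) {f : A ⟶ B} {g : A ⟶ D} {k : A ⟶ E}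
    (hf : c ≫ a' = f) (hg : c ≫ b' = g) (hfk : f ≫ a = k) (hgk : g ≫ b = k) :
    IsRelComp (kerPairMap f) (kerPairMap g) (kerPairMap k) := by
  obtain ⟨x, y, z, hxy, hyz, hr⟩ := exists_of_relCompDom f g
  have hxz : x ≫ k = z ≫ k := by
    rw [← hfk, reassoc_of% hxy, hfk, ← hgk, reassoc_of% hyz]
  let e := pullback.lift x z hxz
  have he : e ≫ kerPairMap k = relCompMap (kerPairMap f) (kerPairMap g) := by
    rw [hr, lift_comp_kerPairMap]
  obtain ⟨X, s, y', _, hs⟩ := RegularCat.exists_local_lift c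
    (sq.lift (pullback.fst k k ≫ f) (pullback.snd k k ≫ g)
      (by simp [hfk, hgk, pullback.condition]))
  obtain ⟨r, hr'⟩ := exists_comp_relCompMap_eq (f := f) (g := g)
    (x := s ≫ pullback.fst k k) (y := y') (z := s ≫ pullback.snd k k)
    (by simp [← hf, reassoc_of% hs])
    (by simp [← hg, reassoc_of% hs])
  have hre : r ≫ e = s := by
    rw [← cancel_mono (kerPairMap k), Category.assoc, he, hr', lift_eq_comp_kerPairMap]
  have : StrongEpi (r ≫ e) := hre ▸ ‹StrongEpi s›
  have := strongEpi_of_strongEpi r e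
  exact ⟨e, RegularCat.regularEpi_of_strongEpi e, he⟩

/-- If the composite of the kernel pairs of two quotients of `A` is the kernel pair of the
diagonal of a square, then `A` covers the pullback. -/
lemma strongEpi_of_isRelComp {Q T : C} {c : A ⟶ Q} {a' : Q ⟶ B} {b' : Q ⟶ D}
    {a : B ⟶ E} {b : D ⟶ E} (sq : IsPullback a' b' a b) {f : A ⟶ B} {g : A ⟶ D} {k : A ⟶ E}
    [StrongEpi f] [StrongEpi g]
    (hf : c ≫ a' = f) (hg : c ≫ b' = g) (hfk : f ≫ a = k) (hgk : g ≫ b = k)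
    {t : T ⟶ A ⨯ A} (ht : IsRelComp (kerPairMap f) (kerPairMap g) t)
    (hs : SameSub t (kerPairMap k)) : StrongEpi c := by
  obtain ⟨X₁, s₁, x, _, hx⟩ := RegularCat.exists_local_lift f a'
  obtain ⟨X₂, s₂, z, _, hz⟩ := RegularCat.exists_local_lift g (s₁ ≫ b')
  have hxz : (s₂ ≫ x) ≫ k = z ≫ k := by
    rw [← hfk, Category.assoc, reassoc_of% hx, hfk, ← hgk, reassoc_of% hz, sq.w]
  obtain ⟨w, hw⟩ := hs.exists_comp_eq hxz
  obtain ⟨e, he, het⟩ := ht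
  have := RegularEpi.toStrongEpi he
  obtain ⟨X₃, s₃, r, _, hr⟩ := RegularCat.exists_local_lift e w
  obtain ⟨x', y', z', hxy, hyz, hxyz⟩ := exists_of_relCompDom f g
  have h : prod.lift (r ≫ x') (r ≫ z') = prod.lift (s₃ ≫ s₂ ≫ x) (s₃ ≫ z) := by
    rw [← prod.comp_lift, ← prod.comp_lift, ← hw, ← hxyz, ← het, reassoc_of% hr]
  have hx' : r ≫ x' = s₃ ≫ s₂ ≫ x := by simpa [prod.lift_fst] using h =≫ prod.fst
  have hz' : r ≫ z' = s₃ ≫ z := by simpa [prod.lift_snd] using h =≫ prod.snd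
  have key : (r ≫ y') ≫ c = s₃ ≫ s₂ ≫ s₁ := by
    apply sq.hom_ext
    · simp only [Category.assoc, hf, ← hxy, reassoc_of% hx', hx]
    · simp only [Category.assoc, hg, hyz, reassoc_of% hz', hz]
  have : StrongEpi ((r ≫ y') ≫ c) := key ▸ inferInstance
  exact strongEpi_of_strongEpi (r ≫ y') c

/-- The composite of the kernel pairs of two ker-commuting quotients is the kernel pair of their
join, whenever the join exists. -/
lemma KerCommute.exists_isRelComp_sameSub {f g k : RegEpiOver A} (h : KerCommute f g)
    (hfk : f.le k) (hgk : g.le k) (hk : ∀ t : RegEpiOver A, f.le t → g.le t → k.le t) :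
    ∃ (T : C) (t : T ⟶ A ⨯ A), IsRelComp (kerPairMap f.hom) (kerPairMap g.hom) t ∧
      SameSub t (kerPairMap k.hom) := by
  obtain ⟨T, t, -, ht, -, B, l, hl⟩ := h
  refine ⟨T, t, ht, ?_⟩
  obtain ⟨e, he, het⟩ := ht
  have := RegularEpi.epi _ he.some
  obtain ⟨x, y, z, hxy, hyz, hxyz⟩ := exists_of_relCompDom f.hom g.hom
  obtain ⟨Z, l', m, hl', _, rfl⟩ := RegularCat.factor l
  have comp_eq : ∀ ⦃X : C⦄ {x y z : X ⟶ A}, x ≫ f.hom = y ≫ f.hom → y ≫ g.hom = z ≫ g.hom →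
      x ≫ l' = z ≫ l' := by
    intro X x y z h₁ h₂
    obtain ⟨r, hr⟩ := exists_comp_relCompMap_eq h₁ h₂
    have := (r ≫ e) ≫= hl.comp_eq
    rw [Category.assoc, reassoc_of% het, reassoc_of% hr, Category.assoc, reassoc_of% het,
      reassoc_of% hr, prod.lift_fst_assoc, prod.lift_snd_assoc] at this
    simpa [← cancel_mono m] using this
  have hkl : k.le ⟨Z, l', hl'⟩ := hk _
    (RegEpiOver.exists_hom_comp_eq _ fun X x z h => comp_eq h rfl)
    (RegEpiOver.exists_hom_comp_eq _ fun X x z h => comp_eq rfl h)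
  constructor
  · have w : t ≫ prod.fst ≫ k.hom = t ≫ prod.snd ≫ k.hom := by
      rw [← cancel_epi e, reassoc_of% het, reassoc_of% het, hxyz, prod.lift_fst_assoc,
        prod.lift_snd_assoc, RegEpiOver.le_iff_forall_comp_eq.1 hfk x y hxy,
        RegEpiOver.le_iff_forall_comp_eq.1 hgk y z hyz]
    refine ⟨pullback.lift (t ≫ prod.fst) (t ≫ prod.snd) (by simpa using w), ?_⟩
    ext <;> simp [lift_comp_kerPairMap, prod.lift_fst, prod.lift_snd]
  · apply hl.exists_comp_eq
    have := RegEpiOver.le_iff_forall_comp_eq.1 hkl _ _ (pullback.condition (f := k.hom))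
    exact by simpa using this =≫ m

end

theorem statement4 [RegularCat C] {A : C}
    (H : P → RegEpiOver A) (hH : ∀ {p q : P}, p ≤ q → (H q).le (H p))
    (G : GammaStar H) :
    -- (1): H preserves binary infima and binary suprema, and its image consists of
    -- pairwise ker-commuting elements
    ((∀ p q : P, (H (p ⊔ q)).le (H p) ∧ (H (p ⊔ q)).le (H q) ∧
        ∀ t : RegEpiOver A, t.le (H p) → t.le (H q) → t.le (H (p ⊔ q))) ∧
     (∀ p q : P, (H p).le (H (p ⊓ q)) ∧ (H q).le (H (p ⊓ q)) ∧
        ∀ t : RegEpiOver A, (H p).le t → (H q).le t → (H (p ⊓ q)).le t) ∧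
     (∀ p q : P, KerCommute (H p) (H q))) ↔
    -- (2): every square of restriction maps of γ_*H is a pullback
    (∀ p q : P, IsPullback (G.map (le_sup_left : p ≤ p ⊔ q))
      (G.map (le_sup_right : q ≤ p ⊔ q))
      (G.map (inf_le_left : p ⊓ q ≤ p)) (G.map (inf_le_right : p ⊓ q ≤ q))) := by
  have hs : ∀ p, StrongEpi (H p).hom := fun p => RegularEpi.toStrongEpi (H p).regEpi
  constructor
  · rintro ⟨hsup, hinf, hker⟩ p q
    obtain ⟨T, t, ht, hts⟩ := (hker p q).exists_isRelComp_sameSub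
      (hinf p q).1 (hinf p q).2.1 (hinf p q).2.2
    have hQ := IsPullback.of_hasPullback (G.map (inf_le_left : p ⊓ q ≤ p))
      (G.map (inf_le_right : p ⊓ q ≤ q))
    have w : G.map (le_sup_left : p ≤ p ⊔ q) ≫ G.map (inf_le_left : p ⊓ q ≤ p) =
        G.map (le_sup_right : q ≤ p ⊔ q) ≫ G.map (inf_le_right : p ⊓ q ≤ q) := by
      rw [← cancel_epi (H (p ⊔ q)).hom, reassoc_of% G.fac, G.fac, reassoc_of% G.fac, G.fac]
    let d := hQ.lift _ _ w
    have : StrongEpi ((H (p ⊔ q)).hom ≫ d) :=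
      strongEpi_of_isRelComp hQ (by simp [d, G.fac]) (by simp [d, G.fac]) (G.fac _) (G.fac _)
        ht hts
    obtain ⟨l, hl⟩ := (hsup p q).2.2
      ⟨_, (H (p ⊔ q)).hom ≫ d, RegularCat.regularEpi_of_strongEpi _⟩
      ⟨pullback.fst _ _, by simp [d, G.fac]⟩ ⟨pullback.snd _ _, by simp [d, G.fac]⟩
    have hdl : d ≫ l = 𝟙 _ := by
      rw [← cancel_epi (H (p ⊔ q)).hom, ← Category.assoc, hl, Category.comp_id]
    have hld : l ≫ d = 𝟙 _ := by
      rw [← cancel_epi ((H (p ⊔ q)).hom ≫ d), ← Category.assoc, hl, Category.comp_id]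
    exact IsPullback.of_iso_pullback ⟨w⟩ ⟨d, l, hdl, hld⟩ (hQ.lift_fst _ _ w) (hQ.lift_snd _ _ w)
  · intro sq
    refine ⟨fun p q => ⟨⟨_, G.fac le_sup_left⟩, ⟨_, G.fac le_sup_right⟩, ?_⟩,
      fun p q => ⟨⟨_, G.fac inf_le_left⟩, ⟨_, G.fac inf_le_right⟩, ?_⟩, fun p q => ?_⟩
    · rintro t ⟨a, ha⟩ ⟨b, hb⟩
      have := RegularEpi.epi _ t.regEpi.some
      refine ⟨(sq p q).lift a b ?_, ?_⟩
      · rw [← cancel_epi t.hom, reassoc_of% ha, reassoc_of% hb, G.fac, G.fac]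
      · apply (sq p q).hom_ext <;> simp [ha, hb, G.fac]
    · rintro t ht₁ ht₂
      rw [RegEpiOver.le_iff_forall_comp_eq] at ht₁ ht₂ ⊢
      intro X x z h
      obtain ⟨X', s, y, _, hy⟩ := RegularCat.exists_local_lift (H (p ⊔ q)).hom
        ((sq p q).lift (x ≫ (H p).hom) (z ≫ (H q).hom) (by simpa [G.fac] using h))
      have h₁ := hy =≫ G.map le_sup_left
      have h₂ := hy =≫ G.map le_sup_right
      simp only [Category.assoc, G.fac, IsPullback.lift_fst, IsPullback.lift_snd] at h₁ h₂
      rw [← cancel_epi s, ← Category.assoc, ← Category.assoc,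
        ← ht₁ y (s ≫ x) (by simpa using h₁), ← ht₂ y (s ≫ z) (by simpa using h₂)]
    · exact ⟨_, kerPairMap (H (p ⊓ q)).hom, inferInstance,
        isRelComp_kerPairMap (sq p q) (G.fac _) (G.fac _) (G.fac _) (G.fac _),
        isRelComp_kerPairMap (sq p q).flip (G.fac _) (G.fac _) (G.fac _) (G.fac _),
        _, _, ⟨𝟙 _, by simp⟩, ⟨𝟙 _, by simp⟩⟩
end

section
/- Let L be a domain. Then: (a) for all x, y ∈ L, y ≪ x if and only if there is a Scott-open filter k on L with x ∈ k ⊆ ↑y; (b) for all x ∈ L and every Scott-open filter k with x ∈ k, there exists y ≪ x with y ∈ k; (c) for Scott-open filters k, l on L, l ≪ k in the poset σFilt(L) if and only if there exists x ∈ k with l ⊆ ↑x; (d) for all x ∈ L and every Scott-open filter k with x ∈ k, there is a Scott-open filter l with l ≪ k (in σFilt(L)) and x ∈ l; (e) for all x ∈ L, the set of Scott-open filters containing x is codirected under inclusion. -/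
open CategoryTheory CategoryTheory.Limits Opposite

universe w v u

section OrderTheory

variable {L : Type w} [PartialOrder L]

/-- x is way below y: for every directed subset D admitting a supremum,
y ≤ sup D implies x ≤ d for some d ∈ D. -/
def WayBelow (x y : L) : Prop :=
  ∀ D : Set L, D.Nonempty → DirectedOn (· ≤ ·) D → ∀ s, IsLUB D s → y ≤ s → ∃ d ∈ D, x ≤ d

/-- ↡x = {y | y ≪ x}. -/
def wb (x : L) : Set L := {y | WayBelow y x}

variable (L) in
/-- A dcpo: every (nonempty) directed subset has a supremum. -/
def IsDcpo : Prop :=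
  ∀ D : Set L, D.Nonempty → DirectedOn (· ≤ ·) D → ∃ s, IsLUB D s

variable (L) in
/-- A domain: a dcpo in which every ↡x is directed with supremum x. -/
def IsDomainL : Prop :=
  IsDcpo L ∧ ∀ x : L, (wb x).Nonempty ∧ DirectedOn (· ≤ ·) (wb x) ∧ IsLUB (wb x) x

/-- A filter on L: a nonempty, upward-closed, codirected subset. -/
def IsFilterSet (k : Set L) : Prop :=
  k.Nonempty ∧ (∀ x ∈ k, ∀ y, x ≤ y → y ∈ k) ∧ DirectedOn (· ≥ ·) k

/-- A Scott-open filter on L. -/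
def IsScottOpenFilter (k : Set L) : Prop :=
  IsFilterSet k ∧
  ∀ D : Set L, D.Nonempty → DirectedOn (· ≤ ·) D → ∀ s, IsLUB D s → s ∈ k → (D ∩ k).Nonempty

variable (L) in
/-- σFilt(L): the poset of Scott-open filters on L, ordered by inclusion. -/
def SFilt : Type w := {k : Set L // IsScottOpenFilter k}

instance : PartialOrder (SFilt L) :=
  inferInstanceAs (PartialOrder {k : Set L // IsScottOpenFilter k})

end OrderTheory

theorem WayBelow.le {L : Type w} [PartialOrder L] {x y : L} (h : WayBelow x y) : x ≤ y := by
  obtain ⟨d, rfl, hd⟩ := h {y} (Set.singleton_nonempty y) (directedOn_singleton y) y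
    isLUB_singleton le_rfl
  exact hd

theorem WayBelow.trans_le {L : Type w} [PartialOrder L] {x y z : L} (h : WayBelow x y)
    (hyz : y ≤ z) : WayBelow x z :=
  fun D hne hD s hs hzs => h D hne hD s hs (hyz.trans hzs)

theorem WayBelow.of_le {L : Type w} [PartialOrder L] {x y z : L} (hxy : x ≤ y)
    (h : WayBelow y z) : WayBelow x z := fun D hne hD s hs hzs =>
  let ⟨d, hd, hyd⟩ := h D hne hD s hs hzs
  ⟨d, hd, hxy.trans hyd⟩

/-- The way-below relation of a domain interpolates. -/
theorem IsDomainL.exists_between {L : Type w} [PartialOrder L] (hdom : IsDomainL L) {x y : L}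
    (h : WayBelow y x) : ∃ z, WayBelow y z ∧ WayBelow z x := by
  obtain ⟨hne, hdir, hlub⟩ := hdom.2 x
  obtain ⟨d, ⟨z, hdz, hzx⟩, hyd⟩ := h {a | ∃ z, WayBelow a z ∧ WayBelow z x}
    (by
      obtain ⟨z, hz⟩ := hne
      obtain ⟨a, ha⟩ := (hdom.2 z).1
      exact ⟨a, z, ha, hz⟩)
    (by
      rintro a ⟨z, haz, hzx⟩ b ⟨t, hbt, htx⟩
      obtain ⟨u, hu, hzu, htu⟩ := hdir z hzx t htx
      obtain ⟨c, hc, hac, hbc⟩ := (hdom.2 u).2.1 a (haz.trans_le hzu) b (hbt.trans_le htu)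
      exact ⟨c, ⟨u, hc, hu⟩, hac, hbc⟩)
    x
    ⟨fun a ⟨_, haz, hzx⟩ => haz.le.trans hzx.le,
      fun b hb => hlub.2 fun z hz => (hdom.2 z).2.2.2 fun a ha => hb ⟨z, ha, hz⟩⟩
    le_rfl
  exact ⟨z, .of_le hyd hdz, hzx⟩

/-- The up-closure of a sequence that descends along the way-below relation is a Scott-open
filter. -/
theorem isScottOpenFilter_of_wayBelow_chain {L : Type w} [PartialOrder L] (f : ℕ → L)
    (hf : ∀ n, WayBelow (f (n + 1)) (f n)) : IsScottOpenFilter {z | ∃ n, f n ≤ z} := by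
  have hanti : Antitone f := antitone_nat_of_succ_le fun n => (hf n).le
  refine ⟨⟨⟨f 0, 0, le_rfl⟩, fun a ⟨n, hn⟩ b hab => ⟨n, hn.trans hab⟩, ?_⟩, ?_⟩
  · rintro a ⟨n, hn⟩ b ⟨m, hm⟩
    exact ⟨f (max n m), ⟨_, le_rfl⟩, (hanti (le_max_left n m)).trans hn,
      (hanti (le_max_right n m)).trans hm⟩
  · rintro D hne hD s hs ⟨n, hn⟩
    obtain ⟨d, hd, hle⟩ := hf n D hne hD s hs hn
    exact ⟨d, hd, n + 1, hle⟩

theorem IsDomainL.exists_isScottOpenFilter {L : Type w} [PartialOrder L] (hdom : IsDomainL L)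
    {x y : L} (h : WayBelow y x) :
    ∃ k : Set L, IsScottOpenFilter k ∧ x ∈ k ∧ k ⊆ {z | y ≤ z} := by
  choose g hyg hg using fun p : {p : L // WayBelow y p} => hdom.exists_between p.2
  let f : ℕ → {p : L // WayBelow y p} := fun n => (fun p => ⟨g p, hyg p⟩)^[n] ⟨x, h⟩
  refine ⟨_, isScottOpenFilter_of_wayBelow_chain (fun n => (f n : L)) fun n => ?_,
    ⟨0, le_rfl⟩, fun z ⟨n, hn⟩ => (f n).2.le.trans hn⟩
  simp only [f, Function.iterate_succ_apply']
  exact hg _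

theorem IsDomainL.exists_wayBelow_mem {L : Type w} [PartialOrder L] (hdom : IsDomainL L)
    {x : L} {k : Set L} (hk : IsScottOpenFilter k) (hx : x ∈ k) :
    ∃ y : L, WayBelow y x ∧ y ∈ k :=
  let ⟨hne, hdir, hlub⟩ := hdom.2 x
  hk.2 (wb x) hne hdir x hlub hx

theorem isScottOpenFilter_biUnion {L : Type w} [PartialOrder L] {D : Set (SFilt L)}
    (hne : D.Nonempty) (hD : DirectedOn (· ≤ ·) D) :
    IsScottOpenFilter {z : L | ∃ d ∈ D, z ∈ d.1} := by
  refine ⟨⟨?_, ?_, ?_⟩, ?_⟩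
  · obtain ⟨d, hd⟩ := hne
    obtain ⟨z, hz⟩ := d.2.1.1
    exact ⟨z, d, hd, hz⟩
  · rintro a ⟨d, hd, ha⟩ b hab
    exact ⟨d, hd, d.2.1.2.1 a ha b hab⟩
  · rintro a ⟨d, hd, ha⟩ b ⟨e, he, hb⟩
    obtain ⟨m, hm, hdm, hem⟩ := hD d hd e he
    obtain ⟨c, hc, hca, hcb⟩ := m.2.1.2.2 a (hdm ha) b (hem hb)
    exact ⟨c, ⟨m, hm, hc⟩, hca, hcb⟩
  · rintro E hE hEdir s hs ⟨d, hd, hsd⟩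
    obtain ⟨e, he, hed⟩ := d.2.2 E hE hEdir s hs hsd
    exact ⟨e, he, d, hd, hed⟩

theorem SFilt.wayBelow_of_subset {L : Type w} [PartialOrder L] {k l : SFilt L} {x : L}
    (hx : x ∈ k.1) (hl : l.1 ⊆ {z | x ≤ z}) : WayBelow l k := by
  intro D hne hD s hs hks
  let U : SFilt L := ⟨_, isScottOpenFilter_biUnion hne hD⟩
  have hsU : s ≤ U := hs.2 fun d hd z hz => ⟨d, hd, hz⟩
  obtain ⟨d, hd, hxd⟩ := hsU (hks hx)
  exact ⟨d, hd, fun z hz => d.2.1.2.1 x hxd z (hl hz)⟩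

theorem IsDomainL.exists_subset_of_sFilt_wayBelow {L : Type w} [PartialOrder L]
    (hdom : IsDomainL L) {k l : SFilt L} (h : WayBelow l k) :
    ∃ x ∈ k.1, l.1 ⊆ {z | x ≤ z} := by
  have key : ∀ x ∈ k.1, ∃ m : SFilt L, (∃ y ∈ k.1, m.1 ⊆ {z | y ≤ z}) ∧ x ∈ m.1 := by
    intro x hx
    obtain ⟨y, hyx, hy⟩ := hdom.exists_wayBelow_mem k.2 hx
    obtain ⟨m, hm, hxm, hmy⟩ := hdom.exists_isScottOpenFilter hyx
    exact ⟨⟨m, hm⟩, ⟨y, hy, hmy⟩, hxm⟩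
  obtain ⟨m, ⟨x, hx, hmx⟩, hlm⟩ := h {m | ∃ y ∈ k.1, m.1 ⊆ {z | y ≤ z}}
    (by
      obtain ⟨x, hx⟩ := k.2.1.1
      obtain ⟨m, hm, -⟩ := key x hx
      exact ⟨m, hm⟩)
    (by
      rintro a ⟨y, hy, hay⟩ b ⟨t, ht, hbt⟩
      obtain ⟨x, hx, hxy, hxt⟩ := k.2.1.2.2 y hy t ht
      obtain ⟨m, hm, hxm⟩ := key x hx
      exact ⟨m, hm, fun z hz => m.2.1.2.1 x hxm z (le_trans hxy (hay hz)),
        fun z hz => m.2.1.2.1 x hxm z (le_trans hxt (hbt hz))⟩)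
    k
    ⟨fun m ⟨y, hy, hmy⟩ z hz => k.2.1.2.1 y hy z (hmy hz),
      fun u hu x hx => let ⟨_, hm, hxm⟩ := key x hx; hu hm hxm⟩
    le_rfl
  exact ⟨x, hx, fun z hz => hmx (hlm hz)⟩

theorem statement11 {L : Type w} [PartialOrder L] (hdom : IsDomainL L) :
    -- (a)
    (∀ x y : L, WayBelow y x ↔
      ∃ k : Set L, IsScottOpenFilter k ∧ x ∈ k ∧ k ⊆ {z | y ≤ z}) ∧
    -- (b)
    (∀ (x : L) (k : Set L), IsScottOpenFilter k → x ∈ k →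
      ∃ y : L, WayBelow y x ∧ y ∈ k) ∧
    -- (c)
    (∀ k l : SFilt L, WayBelow l k ↔ ∃ x ∈ k.1, l.1 ⊆ {z | x ≤ z}) ∧
    -- (d)
    (∀ (x : L) (k : SFilt L), x ∈ k.1 →
      ∃ l : SFilt L, WayBelow l k ∧ x ∈ l.1) ∧
    -- (e)
    (∀ x : L, ({k : SFilt L | x ∈ k.1}).Nonempty ∧
      DirectedOn (· ≥ ·) {k : SFilt L | x ∈ k.1}) := by
  refine ⟨fun x y => ⟨hdom.exists_isScottOpenFilter, ?_⟩,
    fun x k hk hx => hdom.exists_wayBelow_mem hk hx,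
    fun k l => ⟨hdom.exists_subset_of_sFilt_wayBelow,
      fun ⟨x, hx, hl⟩ => SFilt.wayBelow_of_subset hx hl⟩, ?_, fun x => ⟨?_, ?_⟩⟩
  · rintro ⟨k, hk, hx, hky⟩ D hne hD s hs hxs
    obtain ⟨d, hd, hdk⟩ := hk.2 D hne hD s hs (hk.1.2.1 x hx s hxs)
    exact ⟨d, hd, hky hdk⟩
  · intro x k hx
    obtain ⟨y, hyx, hy⟩ := hdom.exists_wayBelow_mem k.2 hx
    obtain ⟨l, hl, hxl, hly⟩ := hdom.exists_isScottOpenFilter hyx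
    exact ⟨⟨l, hl⟩, SFilt.wayBelow_of_subset hy hly, hxl⟩
  · obtain ⟨y, hyx⟩ := (hdom.2 x).1
    obtain ⟨l, hl, hxl, -⟩ := hdom.exists_isScottOpenFilter hyx
    exact ⟨⟨l, hl⟩, hxl⟩
  · intro k hk l hl
    obtain ⟨y, hyx, hy⟩ := hdom.exists_wayBelow_mem k.2 hk
    obtain ⟨t, htx, ht⟩ := hdom.exists_wayBelow_mem l.2 hl
    obtain ⟨u, hux, hyu, htu⟩ := (hdom.2 x).2.1 y hyx t htx
    obtain ⟨m, hm, hxm, hmu⟩ := hdom.exists_isScottOpenFilter hux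
    exact ⟨⟨m, hm⟩, hxm, fun z hz => k.2.1.2.1 y hy z (le_trans hyu (hmu hz)),
      fun z hz => l.2.1.2.1 t ht z (le_trans htu (hmu hz))⟩
end

section
/- (Wilker's condition for continuous lattices.) Let L be a continuous lattice. For all x, y ∈ L and every Scott-open filter l on L such that x ∨ y ∈ l, there exist Scott-open filters k, k' on L with x ∈ k, y ∈ k', and k ∩ k' ⊆ l. -/
open CategoryTheory CategoryTheory.Limits Opposite

universe w v u

section Wilker

variable {L : Type w}

theorem WayBelow.trans_le_s13 [PartialOrder L] {a b c : L} (hab : WayBelow a b) (hbc : b ≤ c) :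
    WayBelow a c :=
  fun D hne hD s hs hcs => hab D hne hD s hs (hbc.trans hcs)

theorem WayBelow.of_le_left [PartialOrder L] {a b c : L} (hbc : WayBelow b c) (hab : a ≤ b) :
    WayBelow a c := fun D hne hD s hs hcs =>
  let ⟨d, hd, hbd⟩ := hbc D hne hD s hs hcs
  ⟨d, hd, hab.trans hbd⟩

theorem WayBelow.le_s13 [PartialOrder L] {a b : L} (hab : WayBelow a b) : a ≤ b := by
  obtain ⟨d, rfl, had⟩ := hab {b} (Set.singleton_nonempty b)
    (directedOn_singleton (r := (· ≤ ·)) b) b isLUB_singleton le_rfl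
  exact had

/-- The interpolation property of the way-below relation. -/
theorem WayBelow.exists_between [PartialOrder L]
    (hcont : ∀ x : L, (wb x).Nonempty ∧ DirectedOn (· ≤ ·) (wb x) ∧ IsLUB (wb x) x)
    {a x : L} (hax : WayBelow a x) : ∃ v, WayBelow a v ∧ WayBelow v x := by
  have hne : {u : L | ∃ v, WayBelow u v ∧ WayBelow v x}.Nonempty := by
    obtain ⟨v, hv⟩ := (hcont x).1
    obtain ⟨u, hu⟩ := (hcont v).1
    exact ⟨u, v, hu, hv⟩
  have hdir : DirectedOn (· ≤ ·) {u : L | ∃ v, WayBelow u v ∧ WayBelow v x} := by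
    rintro u ⟨v, huv, hvx⟩ u' ⟨v', huv', hvx'⟩
    obtain ⟨t, ht, hvt, hvt'⟩ := (hcont x).2.1 v hvx v' hvx'
    obtain ⟨r, hr, hur, hur'⟩ := (hcont t).2.1 u (huv.trans_le_s13 hvt) u' (huv'.trans_le_s13 hvt')
    exact ⟨r, ⟨t, hr, ht⟩, hur, hur'⟩
  have hlub : IsLUB {u : L | ∃ v, WayBelow u v ∧ WayBelow v x} x := by
    refine ⟨?_, fun b hb => ?_⟩
    · rintro u ⟨v, huv, hvx⟩
      exact huv.le_s13.trans hvx.le_s13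
    · exact (hcont x).2.2.2 fun v hv => (hcont v).2.2.2 fun u hu => hb ⟨v, hu, hv⟩
  obtain ⟨u, ⟨v, huv, hvx⟩, hau⟩ := hax _ hne hdir x hlub le_rfl
  exact ⟨v, huv.of_le_left hau, hvx⟩

/-- In a continuous poset, if `a` is way below `x`, some Scott-open filter contains `x` and is
bounded below by `a`. -/
theorem WayBelow.exists_isScottOpenFilter [PartialOrder L]
    (hcont : ∀ x : L, (wb x).Nonempty ∧ DirectedOn (· ≤ ·) (wb x) ∧ IsLUB (wb x) x)
    {a x : L} (hax : WayBelow a x) :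
    ∃ k : Set L, IsScottOpenFilter k ∧ x ∈ k ∧ ∀ z ∈ k, a ≤ z := by
  choose f haf hf using fun p : {v : L // WayBelow a v} => p.2.exists_between hcont
  let g : ℕ → {v : L // WayBelow a v} := fun n => (fun p => ⟨f p, haf p⟩)^[n] ⟨x, hax⟩
  have hg : ∀ n, WayBelow (g (n + 1)).1 (g n).1 := fun n => by
    simp only [g, Function.iterate_succ_apply']
    exact hf _
  have hanti : Antitone fun n => (g n).1 := antitone_nat_of_succ_le fun n => (hg n).le_s13
  refine ⟨{z | ∃ n, (g n).1 ≤ z}, ⟨⟨⟨x, 0, le_rfl⟩, ?_, ?_⟩, ?_⟩, ⟨0, le_rfl⟩, ?_⟩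
  · rintro z ⟨n, hn⟩ y hzy
    exact ⟨n, hn.trans hzy⟩
  · rintro z ⟨n, hn⟩ z' ⟨m, hm⟩
    exact ⟨(g (max n m)).1, ⟨_, le_rfl⟩, (hanti (le_max_left n m)).trans hn,
      (hanti (le_max_right n m)).trans hm⟩
  · rintro D hne hD s hs ⟨n, hn⟩
    obtain ⟨d, hd, hgd⟩ := hg n D hne hD s hs hn
    exact ⟨d, hd, n + 1, hgd⟩
  · rintro z ⟨n, hn⟩
    exact (g n).2.le_s13.trans hn

/-- In a continuous lattice, joins are approximated by joins of way-below elements. -/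
theorem IsScottOpenFilter.exists_wayBelow_sup_mem [Lattice L]
    (hcont : ∀ x : L, (wb x).Nonempty ∧ DirectedOn (· ≤ ·) (wb x) ∧ IsLUB (wb x) x)
    {x y : L} {l : Set L} (hl : IsScottOpenFilter l) (hxy : x ⊔ y ∈ l) :
    ∃ a b, WayBelow a x ∧ WayBelow b y ∧ a ⊔ b ∈ l := by
  obtain ⟨⟨a₀, ha₀⟩, hdx, hlx⟩ := hcont x
  obtain ⟨⟨b₀, hb₀⟩, hdy, hly⟩ := hcont y
  have hdir : DirectedOn (· ≤ ·) (Set.image2 (· ⊔ ·) (wb x) (wb y)) := by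
    rintro _ ⟨a, ha, b, hb, rfl⟩ _ ⟨a', ha', b', hb', rfl⟩
    obtain ⟨c, hc, hac, hac'⟩ := hdx a ha a' ha'
    obtain ⟨d, hd, hbd, hbd'⟩ := hdy b hb b' hb'
    exact ⟨c ⊔ d, ⟨c, hc, d, hd, rfl⟩, sup_le_sup hac hbd, sup_le_sup hac' hbd'⟩
  have hlub : IsLUB (Set.image2 (· ⊔ ·) (wb x) (wb y)) (x ⊔ y) := by
    refine ⟨?_, fun c hc => sup_le (hlx.2 fun a ha => ?_) (hly.2 fun b hb => ?_)⟩
    · rintro _ ⟨a, ha, b, hb, rfl⟩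
      exact sup_le_sup ha.le_s13 hb.le_s13
    · exact le_sup_left.trans (hc ⟨a, ha, b₀, hb₀, rfl⟩)
    · exact le_sup_right.trans (hc ⟨a₀, ha₀, b, hb, rfl⟩)
  obtain ⟨_, ⟨a, ha, b, hb, rfl⟩, hab⟩ :=
    hl.2 _ (Set.Nonempty.image2 ⟨a₀, ha₀⟩ ⟨b₀, hb₀⟩) hdir _ hlub hxy
  exact ⟨a, b, ha, hb, hab⟩

end Wilker

theorem statement13 {L : Type w} [CompleteLattice L]
    (hcont : ∀ x : L, (wb x).Nonempty ∧ DirectedOn (· ≤ ·) (wb x) ∧ IsLUB (wb x) x)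
    (x y : L) (l : Set L) (hl : IsScottOpenFilter l) (hxy : x ⊔ y ∈ l) :
    ∃ k k' : Set L, IsScottOpenFilter k ∧ IsScottOpenFilter k' ∧
      x ∈ k ∧ y ∈ k' ∧ k ∩ k' ⊆ l := by
  obtain ⟨a, b, ha, hb, hab⟩ := hl.exists_wayBelow_sup_mem hcont hxy
  obtain ⟨k, hk, hxk, hak⟩ := ha.exists_isScottOpenFilter hcont
  obtain ⟨k', hk', hyk', hbk'⟩ := hb.exists_isScottOpenFilter hcont
  exact ⟨k, k', hk, hk', hxk, hyk', fun z hz =>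
    hl.1.2.1 _ hab z (sup_le (hak z hz.1) (hbk' z hz.2))⟩
end

section
/- Let L be a domain, C a category, and F : L → C a functor (where L is viewed as a poset category). The following are equivalent: (1) F preserves directed colimits, i.e. for every directed subset D ⊆ L, the cocone (F(d) → F(sup D))_{d∈D} is a colimit of the restriction of F to D; (2) for every x ∈ L, the cocone (F(y) → F(x))_{y ∈ ↡x} is a colimit of the restriction of F to ↡x. -/
open CategoryTheory CategoryTheory.Limits Opposite

universe w v u

section Functors

variable {C : Type u} [Category.{v} C] {J : Type w} [PartialOrder J]

/-- The elementwise statement that the cocone (F(d) → F(s))_{d ∈ D} is a colimit of the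
restriction of the (covariant) functor F to D. -/
def IsColimitOn (F : J ⥤ C) (D : Set J) (s : J) : Prop :=
  ∀ (B : C) (c : ∀ d ∈ D, F.obj d ⟶ B),
    (∀ d e (hd : d ∈ D) (he : e ∈ D) (h : d ≤ e), F.map (homOfLE h) ≫ c e he = c d hd) →
    ∃! u : F.obj s ⟶ B, ∀ d (hd : d ∈ D) (hds : d ≤ s), F.map (homOfLE hds) ≫ u = c d hd

/-- The elementwise statement that the cone (F(s) → F(d))_{d ∈ D} is a limit of the
restriction of the presheaf F to D. -/
def IsLimitOn (F : Jᵒᵖ ⥤ C) (D : Set J) (s : J) : Prop :=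
  ∀ (B : C) (c : ∀ d ∈ D, B ⟶ F.obj (op d)),
    (∀ d e (hd : d ∈ D) (he : e ∈ D) (h : d ≤ e), c e he ≫ F.map (homOfLE h).op = c d hd) →
    ∃! u : B ⟶ F.obj (op s), ∀ d (hd : d ∈ D) (hds : d ≤ s),
      u ≫ F.map (homOfLE hds).op = c d hd

end Functors

/-- The legs of a colimit cocone are jointly epimorphic. -/
theorem IsColimitOn.hom_ext {C : Type u} [Category.{v} C] {J : Type w} [PartialOrder J]
    {F : J ⥤ C} {D : Set J} {s : J} (h : IsColimitOn F D s) (hub : s ∈ upperBounds D)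
    {B : C} {f g : F.obj s ⟶ B}
    (hfg : ∀ d (_ : d ∈ D) (hds : d ≤ s),
      F.map (homOfLE hds) ≫ f = F.map (homOfLE hds) ≫ g) : f = g := by
  refine (h B (fun d hd => F.map (homOfLE (hub hd)) ≫ g) ?_).unique
    (fun d hd hds => hfg d hd hds) (fun d hd hds => rfl)
  intro d e hd he hde
  rw [← Category.assoc, ← F.map_comp]
  rfl

theorem map_homOfLE_comp_eq_of_directedOn {C : Type u} [Category.{v} C] {J : Type w}
    [PartialOrder J] (F : J ⥤ C) {D : Set J} (hD : DirectedOn (· ≤ ·) D) {B : C}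
    (c : ∀ d ∈ D, F.obj d ⟶ B)
    (hc : ∀ d e (hd : d ∈ D) (he : e ∈ D) (h : d ≤ e), F.map (homOfLE h) ≫ c e he = c d hd)
    {y d e : J} (hd : d ∈ D) (he : e ∈ D) (hyd : y ≤ d) (hye : y ≤ e) :
    F.map (homOfLE hyd) ≫ c d hd = F.map (homOfLE hye) ≫ c e he := by
  obtain ⟨m, hm, hdm, hem⟩ := hD d hd e he
  rw [← hc d m hd hm hdm, ← hc e m he hm hem, ← Category.assoc, ← Category.assoc,
    ← F.map_comp, ← F.map_comp]
  rfl

theorem isColimitOn_of_isColimitOn_wb {L : Type w} [PartialOrder L]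
    {C : Type u} [Category.{v} C] {F : L ⥤ C} (hF : ∀ x : L, IsColimitOn F (wb x) x)
    {D : Set L} (hne : D.Nonempty) (hD : DirectedOn (· ≤ ·) D) {s : L} (hs : IsLUB D s) :
    IsColimitOn F D s := by
  intro B c hc
  have hex : ∀ y ∈ wb s, ∃ d ∈ D, y ≤ d := fun y hy => hy D hne hD s hs le_rfl
  choose δ hδ hyδ using hex
  obtain ⟨u, hu, huniq⟩ := hF s B
    (fun y hy => F.map (homOfLE (hyδ y hy)) ≫ c (δ y hy) (hδ y hy)) (by
      intro y z hy hz hyz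
      rw [← Category.assoc, ← F.map_comp]
      exact map_homOfLE_comp_eq_of_directedOn F hD c hc (hδ z hz) (hδ y hy)
        (hyz.trans (hyδ z hz)) (hyδ y hy))
  refine ⟨u, fun d hd hds => ?_, fun v hv => huniq v fun y hy hys => ?_⟩
  · refine (hF d).hom_ext (fun y hy => WayBelow.le hy) fun y hy hyd => ?_
    have hys : y ∈ wb s := WayBelow.trans_le hy hds
    rw [← Category.assoc, ← F.map_comp]
    exact (hu y hys (hyd.trans hds)).trans
      (map_homOfLE_comp_eq_of_directedOn F hD c hc (hδ y hys) hd (hyδ y hys) hyd)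
  · rw [← hv (δ y hy) (hδ y hy) (hs.1 (hδ y hy)), ← Category.assoc, ← F.map_comp]
    rfl

theorem statement14 {L : Type w} [PartialOrder L] (hdom : IsDomainL L)
    {C : Type u} [Category.{v} C] (F : L ⥤ C) :
    -- (1) F preserves directed colimits
    (∀ D : Set L, D.Nonempty → DirectedOn (· ≤ ·) D → ∀ s, IsLUB D s → IsColimitOn F D s) ↔
    -- (2) for every x, the cocone over ↡x is a colimit
    (∀ x : L, IsColimitOn F (wb x) x) := by
  refine ⟨fun h x => ?_, fun h D hne hD s hs => isColimitOn_of_isColimitOn_wb h hne hD hs⟩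
  obtain ⟨hne, hdir, hlub⟩ := hdom.2 x
  exact h (wb x) hne hdir x hlub
end
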